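/- Let K and B be self-adjoint compact operators on a Hilbert space H, with K positive and I + B positive (strictly positive-definite). Let λ_n denote the eigenvalues of K enumerated in decreasing order with multiplicity, with corresponding normalized eigenvectors h_n. Suppose there exist constants a > 0, B̃ > 0 (the exponent), δ > 0, b ∈ ℝ and c > 0 such that λ_n = (a n + b + O(n^{-δ}))^{-B̃} and ‖B h_n‖_H ≤ c n^{-(1+δ)} as n → ∞. Then the eigenvalues 𝛌_n of the generalized eigenproblem K𝐡 = 𝛌(𝐡 + B𝐡), enumerated in decreasing order with multiplicity, satisfy the same two-term asymptotics: 𝛌_n = (a n + b + O(n^{-δ}))^{-B̃} as n → ∞. -/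

import Mathlib

open scoped RealInnerProductSpace
open Filter

/-- `lam n = (a * n + b + O(n ^ (-δ)))^(-B')` as `n → ∞`, where the sequence is indexed
from `0`, so that `lam n` stands for the `(n+1)`-th term of the paper. -/
def HasTwoTermAsymp (lam : ℕ → ℝ) (a b B' δ : ℝ) : Prop :=
  ∃ (r : ℕ → ℝ) (C : ℝ) (N : ℕ),
    (∀ n, N ≤ n → |r n| ≤ C * ((n : ℝ) + 1) ^ (-δ)) ∧
    ∀ n, N ≤ n → lam n = (a * ((n : ℝ) + 1) + b + r n) ^ (-B')

/-- Weighted Schur-type bound for a quadratic form on a finite linear combination. -/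
theorem abs_inner_map_sum_le {H ι : Type*} [NormedAddCommGroup H] [InnerProductSpace ℝ H]
    (B : H →L[ℝ] H) (h : ι → H) (β w : ι → ℝ) (θ : ℝ) (s : Finset ι) (c : ι → ℝ)
    (hβ : ∀ k, 0 ≤ β k) (hw : ∀ k ∈ s, 0 < w k)
    (hB : ∀ j k, |⟪B (h j), h k⟫| ≤ √(β j) * √(β k))
    (hθ : ∑ k ∈ s, β k / w k ≤ θ) :
    |⟪B (∑ k ∈ s, c k • h k), ∑ k ∈ s, c k • h k⟫| ≤ θ * ∑ k ∈ s, w k * c k ^ 2 := by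
  have h1 : |⟪B (∑ k ∈ s, c k • h k), ∑ k ∈ s, c k • h k⟫|
      ≤ (∑ k ∈ s, |c k| * √(β k)) ^ 2 := by
    simp only [map_sum, map_smul, sum_inner, inner_sum, inner_smul_left, inner_smul_right,
      Finset.mul_sum]
    rw [sq, Finset.sum_mul_sum]
    refine (Finset.abs_sum_le_sum_abs (G := ℝ) _ _).trans ?_
    refine Finset.sum_le_sum fun j _ => ?_
    refine (Finset.abs_sum_le_sum_abs (G := ℝ) _ _).trans ?_
    refine Finset.sum_le_sum fun k _ => ?_
    simp only [abs_mul, conj_trivial]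
    have := mul_le_mul_of_nonneg_left (hB k j) (mul_nonneg (abs_nonneg (c j)) (abs_nonneg (c k)))
    linarith
  have h2 : (∑ k ∈ s, |c k| * √(β k)) ^ 2
      ≤ (∑ k ∈ s, β k / w k) * ∑ k ∈ s, w k * c k ^ 2 := by
    refine Finset.sum_sq_le_sum_mul_sum_of_sq_le_mul s
      (fun k hk => div_nonneg (hβ k) (hw k hk).le)
      (fun k hk => mul_nonneg (hw k hk).le (sq_nonneg _)) fun k hk => le_of_eq ?_
    have := (hw k hk).ne'
    rw [mul_pow, sq_abs, Real.sq_sqrt (hβ k)]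
    field_simp
  exact h1.trans (h2.trans (mul_le_mul_of_nonneg_right hθ
    (Finset.sum_nonneg fun k hk => mul_nonneg (hw k hk).le (sq_nonneg _))))

/-- A vector `S`-orthogonal to the first `n` members of a complete `S`-orthonormal system lies
in the closed span of the remaining ones. -/
theorem mem_closure_span_tail {H : Type*} [NormedAddCommGroup H] [InnerProductSpace ℝ H]
    (S : H →L[ℝ] H) (u : ℕ → H)
    (hu : ∀ n m, ⟪S (u n), u m⟫ = if n = m then 1 else 0)
    (hcomplete : (Submodule.span ℝ (Set.range u)).topologicalClosure = ⊤)
    (n : ℕ) (x : H) (hx : ∀ i < n, ⟪S x, u i⟫ = 0) :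
    x ∈ closure (Submodule.span ℝ (u '' Set.Ici n) : Set H) := by
  let P : H → H := fun y => y - ∑ i ∈ Finset.range n, ⟪S y, u i⟫ • u i
  have hP : Continuous P := by fun_prop
  have hPx : P x = x := by
    simp only [P, sub_eq_self]
    exact Finset.sum_eq_zero fun i hi => by rw [hx i (Finset.mem_range.1 hi), zero_smul]
  have hmaps : Set.MapsTo P (Submodule.span ℝ (Set.range u) : Set H)
      (Submodule.span ℝ (u '' Set.Ici n) : Set H) := by
    intro y hy
    refine Submodule.span_induction (p := fun y _ => P y ∈ Submodule.span ℝ (u '' Set.Ici n))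
      ?_ ?_ ?_ ?_ hy
    · rintro _ ⟨k, rfl⟩
      simp only [P, hu, ite_smul, one_smul, zero_smul, Finset.sum_ite_eq, Finset.mem_range]
      split_ifs with hk
      · simp
      · rw [sub_zero]
        exact Submodule.subset_span ⟨k, not_lt.1 hk, rfl⟩
    · simp [P]
    · intro y z _ _ hy hz
      have : P (y + z) = P y + P z := by
        simp only [P, map_add, inner_add_left, add_smul, Finset.sum_add_distrib]
        abel
      rw [this]
      exact add_mem hy hz
    · intro t y _ hy
      have : P (t • y) = t • P y := by
        simp only [P, map_smul, inner_smul_left, conj_trivial, smul_sub, Finset.smul_sum, mul_smul]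
      rw [this]
      exact Submodule.smul_mem _ _ hy
  have hxcl : x ∈ closure (Submodule.span ℝ (Set.range u) : Set H) := by
    rw [← Submodule.topologicalClosure_coe, hcomplete]
    trivial
  simpa [hPx] using map_mem_closure hP hxcl hmaps

/-- `n` homogeneous linear equations in `n + 1` unknowns have a nontrivial solution. -/
theorem exists_ne_zero_sum_mul_eq_zero (n : ℕ) (A : ℕ → ℕ → ℝ) :
    ∃ c : ℕ → ℝ, (∃ i ∈ Finset.range (n + 1), c i ≠ 0) ∧
      ∀ j < n, ∑ i ∈ Finset.range (n + 1), c i * A i j = 0 := by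
  let f : (Fin (n + 1) → ℝ) →ₗ[ℝ] (Fin n → ℝ) :=
    Matrix.mulVecLin (Matrix.of fun (j : Fin n) (i : Fin (n + 1)) => A i j)
  have hf : LinearMap.ker f ≠ ⊥ := LinearMap.ker_ne_bot_of_finrank_lt (by simp)
  obtain ⟨v, hv, hv0⟩ := (Submodule.ne_bot_iff _).1 hf
  obtain ⟨i, hi⟩ := Function.ne_iff.1 hv0
  refine ⟨fun k => if hk : k < n + 1 then v ⟨k, hk⟩ else 0,
    ⟨i, Finset.mem_range.2 i.2, by simpa only [i.2, dif_pos] using! hi⟩, fun j hj => ?_⟩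
  have := congrFun (LinearMap.mem_ker.1 hv) ⟨j, hj⟩
  rw [Finset.sum_range]
  simpa only [Fin.is_lt, dif_pos, f, Matrix.mulVecLin_apply, Matrix.mulVec, dotProduct,
    Matrix.of_apply, Fin.eta, mul_comm] using! this

/-- A trial vector in the span of `u 0, …, u n` that lies in the closed span of the tail
`v n, v (n + 1), …` of a complete orthonormal system. -/
theorem exists_sum_mem_closure_span_tail {H : Type*} [NormedAddCommGroup H]
    [InnerProductSpace ℝ H] (T : H →L[ℝ] H) (v : ℕ → H)
    (hv : ∀ n m, ⟪T (v n), v m⟫ = if n = m then 1 else 0)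
    (hcomplete : (Submodule.span ℝ (Set.range v)).topologicalClosure = ⊤)
    (u : ℕ → H) (n : ℕ) :
    ∃ c : ℕ → ℝ, (∃ i ∈ Finset.range (n + 1), c i ≠ 0) ∧
      ∑ i ∈ Finset.range (n + 1), c i • u i ∈
        closure (Submodule.span ℝ (v '' Set.Ici n) : Set H) := by
  obtain ⟨c, hc, hsum⟩ := exists_ne_zero_sum_mul_eq_zero n fun i j => ⟪T (u i), v j⟫
  refine ⟨c, hc, mem_closure_span_tail T v hv hcomplete n _ fun j hj => ?_⟩
  simpa only [map_sum, map_smul, sum_inner, inner_smul_left, conj_trivial] using hsum j hj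

/-- A quadratic form inequality extends from finite combinations of the tail of a system to
their closure. -/
theorem inner_map_le_of_mem_closure_span_tail {H : Type*} [NormedAddCommGroup H]
    [InnerProductSpace ℝ H] (P Q : H →L[ℝ] H) (v : ℕ → H) (n : ℕ)
    (hPQ : ∀ (s : Finset ℕ) (c : ℕ → ℝ), (∀ k ∈ s, n ≤ k) →
      ⟪P (∑ k ∈ s, c k • v k), ∑ k ∈ s, c k • v k⟫
        ≤ ⟪Q (∑ k ∈ s, c k • v k), ∑ k ∈ s, c k • v k⟫)
    (x : H) (hx : x ∈ closure (Submodule.span ℝ (v '' Set.Ici n) : Set H)) :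
    ⟪P x, x⟫ ≤ ⟪Q x, x⟫ := by
  have hcl : IsClosed {y : H | ⟪P y, y⟫ ≤ ⟪Q y, y⟫} :=
    isClosed_le (by fun_prop) (by fun_prop)
  refine closure_minimal (fun y hy => ?_) hcl hx
  obtain ⟨l, hl, rfl⟩ := (Finsupp.mem_span_image_iff_linearCombination ℝ).1 hy
  exact hPQ l.support l fun k hk => (Finsupp.mem_supported ℝ l).1 hl hk

/-- Diagonal form of `S` on combinations of an `S`-orthonormal system. -/
theorem inner_map_sum_eq_sum_sq {H ι : Type*} [NormedAddCommGroup H]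
    [InnerProductSpace ℝ H] [DecidableEq ι] (S : H →L[ℝ] H) (u : ι → H)
    (hu : ∀ n m, ⟪S (u n), u m⟫ = if n = m then 1 else 0) (s : Finset ι) (c : ι → ℝ) :
    ⟪S (∑ k ∈ s, c k • u k), ∑ k ∈ s, c k • u k⟫ = ∑ k ∈ s, c k ^ 2 := by
  simp only [map_sum, map_smul, sum_inner, inner_sum, inner_smul_left, inner_smul_right,
    conj_trivial, hu]
  refine Finset.sum_congr rfl fun k hk => ?_
  simp [hk, sq]

/-- Diagonal form of `K` on combinations of generalized eigenvectors of the pair `K`, `S`. -/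
theorem inner_map_sum_eq_sum_mul_sq {H ι : Type*} [NormedAddCommGroup H]
    [InnerProductSpace ℝ H] [DecidableEq ι] (K S : H →L[ℝ] H) (u : ι → H) (ν : ι → ℝ)
    (hu : ∀ n m, ⟪S (u n), u m⟫ = if n = m then 1 else 0)
    (hK : ∀ n, K (u n) = ν n • S (u n)) (s : Finset ι) (c : ι → ℝ) :
    ⟪K (∑ k ∈ s, c k • u k), ∑ k ∈ s, c k • u k⟫ = ∑ k ∈ s, ν k * c k ^ 2 := by
  simp only [map_sum, map_smul, sum_inner, inner_sum, inner_smul_left, inner_smul_right,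
    conj_trivial, hu, hK]
  refine Finset.sum_congr rfl fun k hk => ?_
  simp [hk, sq]
  ring

/-- Comparison of the `n`-th eigenvalues of `K` and of the pair `K`, `I + B` when `B` is small
relative to the spectral gaps of `K` around its `n`-th eigenvalue. -/
theorem abs_eigenvalue_sub_le {H : Type*} [NormedAddCommGroup H] [InnerProductSpace ℝ H]
    (K B : H →L[ℝ] H)
    (hIBpos : ∃ c₀ > (0 : ℝ), ∀ x : H, c₀ * ‖x‖ ^ 2 ≤ ⟪x + B x, x⟫)
    (lam : ℕ → ℝ) (h : ℕ → H)
    (hlpos : ∀ n, 0 < lam n) (hlanti : Antitone lam)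
    (heig : ∀ n, K (h n) = lam n • h n)
    (hon : Orthonormal ℝ h)
    (hcomplete : (Submodule.span ℝ (Set.range h)).topologicalClosure = ⊤)
    (mu : ℕ → ℝ) (g : ℕ → H) (hmanti : Antitone mu)
    (hgeig : ∀ n, K (g n) = mu n • (g n + B (g n)))
    (hgon : ∀ n m, ⟪g n + B (g n), g m⟫ = if n = m then 1 else 0)
    (hgcomplete : (Submodule.span ℝ (Set.range g)).topologicalClosure = ⊤)
    (β : ℕ → ℝ) (hβ : ∀ k, 0 ≤ β k)
    (hB : ∀ j k, |⟪B (h j), h k⟫| ≤ √(β j) * √(β k))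
    (n : ℕ) (ε : ℝ) (hε : 0 < ε) (hε1 : ε ≤ 1)
    (hsum : ∀ s : Finset ℕ, ∑ k ∈ s, β k / (|lam k - lam n| / lam n + ε) ≤ 1 / 2) :
    |mu n - lam n| ≤ ε * lam n := by
  let I : H →L[ℝ] H := ContinuousLinearMap.id ℝ H
  have hh : ∀ n m, ⟪I (h n), h m⟫ = if n = m then 1 else 0 := orthonormal_iff_ite.1 hon
  have hKh : ∀ n, K (h n) = lam n • I (h n) := heig
  have hgg : ∀ n m, ⟪(I + B) (g n), g m⟫ = if n = m then 1 else 0 := hgon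
  have hKg : ∀ n, K (g n) = mu n • (I + B) (g n) := hgeig
  have hln := hlpos n
  have hw : ∀ k, 0 < |lam k - lam n| / lam n + ε := fun k => by positivity
  have hBs := fun (s : Finset ℕ) (c : ℕ → ℝ) => abs_inner_map_sum_le B h β
    (fun k => |lam k - lam n| / lam n + ε) (1 / 2) s c hβ (fun k _ => hw k) hB (hsum s)
  have hsplit : ∀ x, ⟪(I + B) x, x⟫ = ⟪I x, x⟫ + ⟪B x, x⟫ := fun x => by
    simp [inner_add_left]
  have hpos : ∀ x ≠ 0, 0 < ⟪(I + B) x, x⟫ := by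
    obtain ⟨c₀, hc₀, hco⟩ := hIBpos
    intro x hx
    have : 0 < ‖x‖ := norm_pos_iff.2 hx
    exact lt_of_lt_of_le (by positivity) (hco x)
  rw [abs_le]
  constructor
  · obtain ⟨c, ⟨i, hi, hci⟩, hx⟩ :=
      exists_sum_mem_closure_span_tail (I + B) g hgg hgcomplete h n
    have hup := inner_map_le_of_mem_closure_span_tail K (mu n • (I + B)) g n
      (fun s c hs => by
        rw [inner_map_sum_eq_sum_mul_sq K (I + B) g mu hgg hKg, smul_apply,
          inner_smul_left, inner_map_sum_eq_sum_sq (I + B) g hgg, conj_trivial, Finset.mul_sum]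
        exact Finset.sum_le_sum fun k hk =>
          mul_le_mul_of_nonneg_right (hmanti (hs k hk)) (sq_nonneg _)) _ hx
    have hb := hBs (Finset.range (n + 1)) c
    have hK := inner_map_sum_eq_sum_mul_sq K I h lam hh hKh (Finset.range (n + 1)) c
    have hI := inner_map_sum_eq_sum_sq I h hh (Finset.range (n + 1)) c
    have hne : ∑ k ∈ Finset.range (n + 1), c k • h k ≠ 0 := by
      intro h0
      rw [h0, inner_zero_right, eq_comm, Finset.sum_eq_zero_iff_of_nonneg (by intros; positivity)]
        at hI
      exact hci (by simpa using hI i hi)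
    have hw' : ∑ k ∈ Finset.range (n + 1), (|lam k - lam n| / lam n + ε) * c k ^ 2
        = (∑ k ∈ Finset.range (n + 1), lam k * c k ^ 2) / lam n
          - (1 - ε) * ∑ k ∈ Finset.range (n + 1), c k ^ 2 := by
      rw [Finset.sum_div, Finset.mul_sum, ← Finset.sum_sub_distrib]
      refine Finset.sum_congr rfl fun k hk => ?_
      rw [abs_of_nonneg (sub_nonneg.2 (hlanti (Nat.lt_succ_iff.1 (Finset.mem_range.1 hk))))]
      field_simp
      ring
    have hpq : ∑ k ∈ Finset.range (n + 1), c k ^ 2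
        ≤ (∑ k ∈ Finset.range (n + 1), lam k * c k ^ 2) / lam n := by
      rw [Finset.sum_div]
      refine Finset.sum_le_sum fun k hk => ?_
      rw [le_div_iff₀ hln, mul_comm]
      exact mul_le_mul_of_nonneg_right
        (hlanti (Nat.lt_succ_iff.1 (Finset.mem_range.1 hk))) (sq_nonneg _)
    have hp := hpos _ hne
    rw [hw', ← hK, ← hI] at hb
    rw [← hK, ← hI] at hpq
    rw [smul_apply, inner_smul_left, conj_trivial] at hup
    have hs := hsplit (∑ k ∈ Finset.range (n + 1), c k • h k)
    generalize ∑ k ∈ Finset.range (n + 1), c k • h k = x at *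
    obtain ⟨q, hq⟩ : ∃ q, q = ⟪K x, x⟫ / lam n := ⟨_, rfl⟩
    have hq' : ⟪K x, x⟫ = lam n * q := by rw [hq]; field_simp
    rw [← hq] at hb hpq
    rw [hq'] at hup
    have hb2 := (abs_le.1 hb).2
    have hip : 0 ≤ ⟪I x, x⟫ := real_inner_self_nonneg
    have h1 : (1 - ε) * ⟪(I + B) x, x⟫ ≤ q := by
      nlinarith [mul_nonneg hε.le (sub_nonneg.2 hpq), mul_nonneg hε.le (hip.trans hpq),
        mul_nonneg (sub_nonneg.2 hε1) (sub_nonneg.2 hpq),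
        mul_nonneg hε.le (mul_nonneg hε.le (hip.trans hpq)),
        mul_le_mul_of_nonneg_left hb2 (sub_nonneg.2 hε1),
        mul_nonneg hε.le (mul_nonneg hε.le hip)]
    have h2 : lam n * (1 - ε) * ⟪(I + B) x, x⟫ ≤ mu n * ⟪(I + B) x, x⟫ := by
      refine le_trans ?_ hup
      rw [mul_assoc]
      exact mul_le_mul_of_nonneg_left h1 hln.le
    linarith [le_of_mul_le_mul_right h2 hp]
  · obtain ⟨c, ⟨i, hi, hci⟩, hx⟩ := exists_sum_mem_closure_span_tail I h hh hcomplete g n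
    have hup := inner_map_le_of_mem_closure_span_tail K ((lam n * (1 + ε)) • (I + B)) h n
      (fun s c hs => by
        have hb := hBs s c
        have hK := inner_map_sum_eq_sum_mul_sq K I h lam hh hKh s c
        have hI := inner_map_sum_eq_sum_sq I h hh s c
        have hw' : ∑ k ∈ s, (|lam k - lam n| / lam n + ε) * c k ^ 2
            = (1 + ε) * ∑ k ∈ s, c k ^ 2 - (∑ k ∈ s, lam k * c k ^ 2) / lam n := by
          rw [Finset.sum_div, Finset.mul_sum, ← Finset.sum_sub_distrib]
          refine Finset.sum_congr rfl fun k hk => ?_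
          rw [abs_of_nonpos (sub_nonpos.2 (hlanti (hs k hk)))]
          field_simp
          ring
        have hpq : (∑ k ∈ s, lam k * c k ^ 2) / lam n ≤ ∑ k ∈ s, c k ^ 2 := by
          rw [Finset.sum_div]
          refine Finset.sum_le_sum fun k hk => ?_
          rw [div_le_iff₀ hln, mul_comm (c k ^ 2)]
          exact mul_le_mul_of_nonneg_right (hlanti (hs k hk)) (sq_nonneg _)
        have hq0 : 0 ≤ (∑ k ∈ s, lam k * c k ^ 2) / lam n :=
          div_nonneg (Finset.sum_nonneg fun k _ =>
            mul_nonneg (hlpos k).le (sq_nonneg _)) hln.le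
        rw [hw', ← hK, ← hI] at hb
        rw [← hK, ← hI] at hpq
        rw [← hK] at hq0
        rw [smul_apply, inner_smul_left, conj_trivial, hsplit]
        generalize ∑ k ∈ s, c k • h k = x at *
        obtain ⟨q, hq⟩ : ∃ q, q = ⟪K x, x⟫ / lam n := ⟨_, rfl⟩
        have hq' : ⟪K x, x⟫ = lam n * q := by rw [hq]; field_simp
        rw [← hq] at hb hpq hq0
        rw [hq', mul_assoc]
        refine mul_le_mul_of_nonneg_left ?_ hln.le
        have hb2 := (abs_le.1 hb).1
        nlinarith [mul_nonneg hε.le (sub_nonneg.2 hpq), mul_nonneg hε.le hq0,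
          mul_nonneg (sub_nonneg.2 hε1) (sub_nonneg.2 hpq),
          mul_nonneg (mul_nonneg hε.le (sub_nonneg.2 hε1)) hq0,
          mul_nonneg (mul_nonneg hε.le (sub_nonneg.2 hε1)) (sub_nonneg.2 hpq),
          mul_le_mul_of_nonneg_left hb2 (add_pos one_pos hε).le]) _ hx
    have hK := inner_map_sum_eq_sum_mul_sq K (I + B) g mu hgg hKg (Finset.range (n + 1)) c
    have hI := inner_map_sum_eq_sum_sq (I + B) g hgg (Finset.range (n + 1)) c
    have hne : ∑ k ∈ Finset.range (n + 1), c k • g k ≠ 0 := by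
      intro h0
      rw [h0, inner_zero_right, eq_comm, Finset.sum_eq_zero_iff_of_nonneg (by intros; positivity)]
        at hI
      exact hci (by simpa using hI i hi)
    have hlow : mu n * ∑ k ∈ Finset.range (n + 1), c k ^ 2
        ≤ ∑ k ∈ Finset.range (n + 1), mu k * c k ^ 2 := by
      rw [Finset.mul_sum]
      exact Finset.sum_le_sum fun k hk => mul_le_mul_of_nonneg_right
        (hmanti (Nat.lt_succ_iff.1 (Finset.mem_range.1 hk))) (sq_nonneg _)
    rw [← hK, ← hI] at hlow
    rw [smul_apply, inner_smul_left, conj_trivial] at hup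
    linarith [le_of_mul_le_mul_right (hlow.trans hup) (hpos _ hne)]

theorem tendsto_natCast_add_one_rpow_neg {δ : ℝ} (hδ : 0 < δ) :
    Tendsto (fun n : ℕ => ((n : ℝ) + 1) ^ (-δ)) atTop (nhds 0) :=
  (tendsto_rpow_neg_atTop hδ).comp
    (tendsto_atTop_add_const_right _ _ tendsto_natCast_atTop_atTop)

/-- Normal form of a two-term asymptotics: the base is comparable to `a * (n + 1)`. -/
theorem HasTwoTermAsymp.exists_base {lam : ℕ → ℝ} {a b B' δ : ℝ} (ha : 0 < a) (hδ : 0 < δ)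
    (H : HasTwoTermAsymp lam a b B' δ) :
    ∃ (r : ℕ → ℝ) (C : ℝ) (N : ℕ), ∀ n, N ≤ n →
      |r n| ≤ C * ((n : ℝ) + 1) ^ (-δ) ∧ |r n| ≤ a / 4 ∧
      a * ((n : ℝ) + 1) / 2 ≤ a * ((n : ℝ) + 1) + b + r n ∧
      a * ((n : ℝ) + 1) + b + r n ≤ 2 * (a * ((n : ℝ) + 1)) ∧
      lam n = (a * ((n : ℝ) + 1) + b + r n) ^ (-B') := by
  obtain ⟨r, C, N, hr, hl⟩ := H
  have h1 : Tendsto (fun n : ℕ => C * ((n : ℝ) + 1) ^ (-δ)) atTop (nhds 0) := by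
    simpa using (tendsto_natCast_add_one_rpow_neg hδ).const_mul C
  have h2 : ∀ᶠ n : ℕ in atTop, C * ((n : ℝ) + 1) ^ (-δ) ≤ a / 4 :=
    h1.eventually_le_const (by positivity)
  have h3 : ∀ᶠ n : ℕ in atTop, 4 * |b| / a ≤ (n : ℝ) :=
    tendsto_natCast_atTop_atTop.eventually_ge_atTop _
  obtain ⟨M, hM⟩ := eventually_atTop.1 (h2.and h3)
  refine ⟨r, C, max N M, fun n hn => ?_⟩
  have hrn := hr n ((le_max_left _ _).trans hn)
  obtain ⟨hC, hb⟩ := hM n ((le_max_right _ _).trans hn)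
  have hra := hrn.trans hC
  rw [div_le_iff₀ ha] at hb
  have hn0 : (0 : ℝ) ≤ n := n.cast_nonneg
  obtain ⟨hr1, hr2⟩ := abs_le.1 hra
  refine ⟨hrn, hra, ?_, ?_, hl n ((le_max_left _ _).trans hn)⟩ <;>
    nlinarith [neg_abs_le b, le_abs_self b, mul_nonneg hn0 ha.le]

/-- Relative gap between two terms of a sequence with two-term power asymptotics. -/
theorem HasTwoTermAsymp.exists_gap {lam : ℕ → ℝ} {a b B' δ : ℝ} (ha : 0 < a) (hB' : 0 < B')
    (hδ : 0 < δ) (H : HasTwoTermAsymp lam a b B' δ) :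
    ∃ κ > (0 : ℝ), ∃ N : ℕ, ∀ j k : ℕ, N ≤ j → j < k →
      lam k * (1 + κ * (((k : ℝ) - j) / (k + 1))) ≤ lam j := by
  obtain ⟨r, C, N, hN⟩ := H.exists_base ha hδ
  refine ⟨B' / 4, by positivity, N, fun j k hj hjk => ?_⟩
  obtain ⟨-, hrj, hjl, hju, hlj⟩ := hN j hj
  obtain ⟨-, hrk, hkl, hku, hlk⟩ := hN k (hj.trans hjk.le)
  have hLj : 0 < a * ((j : ℝ) + 1) + b + r j := lt_of_lt_of_le (by positivity) hjl
  have hLk : 0 < a * ((k : ℝ) + 1) + b + r k := lt_of_lt_of_le (by positivity) hkl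
  have hd : a * ((k : ℝ) - j) / 2
      ≤ (a * ((k : ℝ) + 1) + b + r k) - (a * ((j : ℝ) + 1) + b + r j) := by
    have : (j : ℝ) + 1 ≤ k := by exact_mod_cast hjk
    nlinarith [abs_le.1 hrj, abs_le.1 hrk]
  rw [hlj, hlk]
  generalize a * ((j : ℝ) + 1) + b + r j = x at *
  generalize a * ((k : ℝ) + 1) + b + r k = y at *
  have hlog : ((k : ℝ) - j) / (k + 1) / 4 ≤ Real.log (y / x) := by
    refine le_trans ?_ (Real.one_sub_inv_le_log_of_pos (div_pos hLk hLj))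
    rw [inv_div, one_sub_div hLk.ne', div_div, div_le_div_iff₀ (by positivity) hLk]
    have hkj : (0 : ℝ) ≤ k - j := by
      have : (j : ℝ) < k := by exact_mod_cast hjk
      linarith
    nlinarith [mul_le_mul_of_nonneg_left hku hkj,
      mul_le_mul_of_nonneg_right hd (by positivity : (0 : ℝ) ≤ (k + 1) * 4)]
  have hx : x ^ (-B') = y ^ (-B') * (y / x) ^ B' := by
    rw [Real.div_rpow hLk.le hLj.le, Real.rpow_neg hLk.le, Real.rpow_neg hLj.le]
    have := (Real.rpow_pos_of_pos hLk B').ne'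
    field_simp
  rw [hx]
  refine mul_le_mul_of_nonneg_left ?_ (Real.rpow_nonneg hLk.le _)
  rw [Real.rpow_def_of_pos (div_pos hLk hLj)]
  refine le_trans ?_ (Real.add_one_le_exp _)
  nlinarith [mul_le_mul_of_nonneg_left hlog hB'.le]

/-- Two-sided relative gap around the `n`-th term, uniform over all other indices. -/
theorem HasTwoTermAsymp.exists_abs_gap {lam : ℕ → ℝ} {a b B' δ : ℝ} (ha : 0 < a)
    (hB' : 0 < B') (hδ : 0 < δ) (hlpos : ∀ n, 0 < lam n) (hlanti : Antitone lam)
    (H : HasTwoTermAsymp lam a b B' δ) :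
    ∃ κ > (0 : ℝ), ∃ N : ℕ, ∀ n k : ℕ, N ≤ n →
      κ * (|(k : ℝ) - n| / (max (k : ℝ) n + 1)) ≤ |lam k - lam n| / lam n := by
  obtain ⟨κ, hκ, N, hgap⟩ := H.exists_gap ha hB' hδ
  refine ⟨κ / (2 * (1 + κ)), by positivity, 2 * N + 1, fun n k hn => ?_⟩
  have hln := hlpos n
  have hle : κ / (2 * (1 + κ)) ≤ κ / 2 :=
    div_le_div_of_nonneg_left hκ.le two_pos (by linarith)
  have hle' : κ / (2 * (1 + κ)) ≤ κ / (1 + κ) :=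
    div_le_div_of_nonneg_left hκ.le (by linarith) (by linarith)
  rw [le_div_iff₀ hln]
  rcases lt_trichotomy k n with hkn | rfl | hkn
  · have hkn' : (k : ℝ) < n := by exact_mod_cast hkn
    rw [abs_of_neg (by linarith), max_eq_right hkn'.le,
      abs_of_nonneg (sub_nonneg.2 (hlanti hkn.le)), neg_sub]
    have key : lam n * (κ / 2 * (((n : ℝ) - k) / (n + 1))) ≤ lam k - lam n := by
      have hmono : κ / 2 * (((n : ℝ) - k) / (n + 1))
          ≤ κ * (((n : ℝ) - (max k N : ℕ)) / (n + 1)) := by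
        rw [mul_div_assoc', mul_div_assoc']
        refine div_le_div_of_nonneg_right ?_ (by positivity)
        have hm : (n : ℝ) - k ≤ 2 * ((n : ℝ) - (max k N : ℕ)) := by
          rcases le_total k N with hkN | hkN
          · rw [max_eq_right hkN]
            have : (2 * N + 1 : ℝ) ≤ n := by exact_mod_cast hn
            have : (0 : ℝ) ≤ k := k.cast_nonneg
            linarith
          · rw [max_eq_left hkN]
            linarith
        nlinarith
      have h1 := hgap (max k N) n (le_max_right _ _) (by omega)
      have h2 := hlanti (le_max_left k N)
      nlinarith [mul_le_mul_of_nonneg_left hmono hln.le]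
    refine le_trans ?_ key
    rw [mul_comm (lam n)]
    have : 0 ≤ ((n : ℝ) - k) / (n + 1) := div_nonneg (by linarith) (by positivity)
    gcongr
  · simp
  · have hkn' : (n : ℝ) < k := by exact_mod_cast hkn
    rw [abs_of_pos (by linarith), max_eq_left hkn'.le,
      abs_of_nonpos (sub_nonpos.2 (hlanti hkn.le)), neg_sub]
    have h1 := hgap n k (by omega) hkn
    have ht0 : 0 ≤ ((k : ℝ) - n) / (k + 1) := div_nonneg (by linarith) (by positivity)
    have ht1 : ((k : ℝ) - n) / (k + 1) ≤ 1 := by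
      rw [div_le_one (by positivity)]
      linarith [(n.cast_nonneg : (0 : ℝ) ≤ n)]
    generalize ((k : ℝ) - n) / (k + 1) = t at *
    refine (mul_le_mul_of_nonneg_right (mul_le_mul_of_nonneg_right hle' ht0) hln.le).trans ?_
    rw [div_mul_eq_mul_div, div_mul_eq_mul_div, div_le_iff₀ (by positivity)]
    have h2 : lam k * (1 + κ) ≤ lam n + lam k * κ * (1 - t) := by nlinarith
    have h3 : lam k * κ * (1 - t) ≤ lam n * κ * (1 - t) := by
      have := hlanti hkn.le
      gcongr
    nlinarith

/-- A two-term power asymptotics is stable under relative perturbations of order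
`n ^ (-(1 + δ))`. -/
theorem HasTwoTermAsymp.of_abs_sub_le {lam mu : ℕ → ℝ} {a b B' δ D : ℝ} (ha : 0 < a)
    (hB' : 0 < B') (hδ : 0 < δ) (hlpos : ∀ n, 0 < lam n) (hmpos : ∀ n, 0 < mu n)
    (H : HasTwoTermAsymp lam a b B' δ)
    (hclose : ∀ᶠ n in atTop, |mu n - lam n| ≤ D * ((n : ℝ) + 1) ^ (-(1 + δ)) * lam n) :
    HasTwoTermAsymp mu a b B' δ := by
  obtain ⟨r, C, N, hN⟩ := H.exists_base ha hδ
  have hratio : ∀ᶠ n in atTop, |mu n / lam n - 1| ≤ D * ((n : ℝ) + 1) ^ (-(1 + δ)) := by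
    filter_upwards [hclose] with n hn
    rw [div_sub_one (hlpos n).ne', abs_div, abs_of_pos (hlpos n), div_le_iff₀ (hlpos n)]
    exact hn
  have hlim : Tendsto (fun n => mu n / lam n) atTop (nhds 1) := by
    rw [tendsto_iff_norm_sub_tendsto_zero]
    refine squeeze_zero' (Eventually.of_forall fun n => norm_nonneg _) hratio ?_
    simpa using (tendsto_natCast_add_one_rpow_neg (by linarith : 0 < 1 + δ)).const_mul D
  have hO := ((Real.hasDerivAt_rpow_const (x := 1) (p := -B'⁻¹)
    (Or.inl one_ne_zero)).isBigO_sub).comp_tendsto hlim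
  obtain ⟨E, hE, hEb⟩ := hO.exists_pos
  have hall := (hEb.bound.and hratio).and (eventually_ge_atTop N)
  obtain ⟨M, hM⟩ := eventually_atTop.1 hall
  refine ⟨fun n => (mu n) ^ (-B'⁻¹) - a * ((n : ℝ) + 1) - b, C + 2 * a * E * D, M,
    fun n hn => ?_, fun n hn => ?_⟩
  · obtain ⟨⟨h1, h2⟩, hnN⟩ := hM n hn
    obtain ⟨hr, -, hl, hu, hlam⟩ := hN n hnN
    have hL : 0 < a * ((n : ℝ) + 1) + b + r n := lt_of_lt_of_le (by positivity) hl
    have hmu : mu n ^ (-B'⁻¹)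
        = (a * ((n : ℝ) + 1) + b + r n) * (mu n / lam n) ^ (-B'⁻¹) := by
      rw [Real.div_rpow (hmpos n).le (hlpos n).le]
      have : lam n ^ (-B'⁻¹) = a * ((n : ℝ) + 1) + b + r n := by
        rw [hlam, ← Real.rpow_mul hL.le, neg_mul_neg, mul_inv_cancel₀ hB'.ne', Real.rpow_one]
      rw [this]
      field_simp
    simp only [Function.comp, Real.one_rpow, Real.norm_eq_abs] at h1
    have h3 := h1.trans (mul_le_mul_of_nonneg_left h2 hE.le)
    have hpow : ((n : ℝ) + 1) * ((n : ℝ) + 1) ^ (-(1 + δ)) = ((n : ℝ) + 1) ^ (-δ) := by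
      have hn1 : (0 : ℝ) < (n : ℝ) + 1 := by positivity
      rw [← Real.rpow_one_add' hn1.le (by linarith)]
      congr 1
      ring
    have hsplit : mu n ^ (-B'⁻¹) - a * ((n : ℝ) + 1) - b
        = r n + (a * ((n : ℝ) + 1) + b + r n) * ((mu n / lam n) ^ (-B'⁻¹) - 1) := by
      rw [hmu]
      ring
    simp only
    rw [hsplit]
    refine (abs_add_le _ _).trans ?_
    rw [abs_mul, abs_of_pos hL]
    calc _ ≤ C * ((n : ℝ) + 1) ^ (-δ) + 2 * (a * ((n : ℝ) + 1)) *
          (E * (D * ((n : ℝ) + 1) ^ (-(1 + δ)))) :=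
          add_le_add hr (mul_le_mul hu h3 (abs_nonneg _) (by positivity))
      _ = C * ((n : ℝ) + 1) ^ (-δ)
          + 2 * a * E * D * (((n : ℝ) + 1) * ((n : ℝ) + 1) ^ (-(1 + δ))) := by ring
      _ = _ := by rw [hpow]; ring
  · have : a * ((n : ℝ) + 1) + b + (mu n ^ (-B'⁻¹) - a * ((n : ℝ) + 1) - b)
        = mu n ^ (-B'⁻¹) := by ring
    simp only
    rw [this, ← Real.rpow_mul (hmpos n).le, neg_mul_neg, inv_mul_cancel₀ hB'.ne', Real.rpow_one]

theorem HasTwoTermAsymp.tendsto_zero {lam : ℕ → ℝ} {a b B' δ : ℝ} (ha : 0 < a)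
    (hB' : 0 < B') (hδ : 0 < δ) (H : HasTwoTermAsymp lam a b B' δ) :
    Tendsto lam atTop (nhds 0) := by
  obtain ⟨r, C, N, hN⟩ := H.exists_base ha hδ
  have hL : Tendsto (fun n : ℕ => a * ((n : ℝ) + 1) + b + r n) atTop atTop := by
    have h1 : Tendsto (fun n : ℕ => a / 2 * ((n : ℝ) + 1)) atTop atTop :=
      (tendsto_atTop_add_const_right _ _ tendsto_natCast_atTop_atTop).const_mul_atTop
        (by positivity)
    refine tendsto_atTop_mono' _ ?_ h1
    filter_upwards [eventually_ge_atTop N] with n hn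
    linarith [(hN n hn).2.2.1]
  refine ((tendsto_rpow_neg_atTop hB').comp hL).congr' ?_
  filter_upwards [eventually_ge_atTop N] with n hn
  exact ((hN n hn).2.2.2.2).symm

theorem summable_natCast_add_one_rpow_neg {δ : ℝ} (hδ : 0 < δ) :
    Summable fun k : ℕ => ((k : ℝ) + 1) ^ (-(1 + δ)) := by
  have := (summable_nat_add_iff 1).2 (Real.summable_nat_rpow.2 (by linarith : -(1 + δ) < -1))
  simpa using this

/-- The contribution of the low indices, where the relative gap tends to infinity. -/
theorem tendsto_tsum_low_indices {lam β : ℕ → ℝ} {κ : ℝ} (hκ : 0 < κ) (N : ℕ)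
    (hlpos : ∀ n, 0 < lam n) (hlim : Tendsto lam atTop (nhds 0))
    (hβ : ∀ k, 0 ≤ β k) (hβs : Summable β)
    (hgap : ∀ n k : ℕ, N ≤ n →
      κ * (|(k : ℝ) - n| / (max (k : ℝ) n + 1)) ≤ |lam k - lam n| / lam n) :
    (∀ n, N ≤ n → Summable fun k => if 2 * k < n then β k / (|lam k - lam n| / lam n) else 0) ∧
    Tendsto (fun n => ∑' k, if 2 * k < n then β k / (|lam k - lam n| / lam n) else 0)
      atTop (nhds 0) := by
  have hnn : ∀ n k, 0 ≤ if 2 * k < n then β k / (|lam k - lam n| / lam n) else 0 := by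
    intro n k
    have := hlpos n
    have := hβ k
    split_ifs <;> positivity
  have hbd : ∀ n, N ≤ n → ∀ k,
      (if 2 * k < n then β k / (|lam k - lam n| / lam n) else 0) ≤ β k * (2 / κ) := by
    intro n hn k
    split_ifs with hk
    · have hk' : (2 * k + 1 : ℝ) ≤ n := by exact_mod_cast hk
      have hk0 : (0 : ℝ) ≤ k := k.cast_nonneg
      have hw : κ / 2 ≤ |lam k - lam n| / lam n := by
        refine le_trans ?_ (hgap n k hn)
        rw [abs_of_neg (by linarith), max_eq_right (by linarith), div_eq_mul_one_div]
        refine mul_le_mul_of_nonneg_left ?_ hκ.le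
        rw [div_le_div_iff₀ two_pos (by positivity)]
        linarith
      rw [div_eq_mul_inv]
      refine mul_le_mul_of_nonneg_left ?_ (hβ k)
      rw [← inv_div κ 2]
      exact inv_anti₀ (by positivity) hw
    · have := hβ k
      positivity
  have hsum := hβs.mul_right (2 / κ)
  refine ⟨fun n hn => Summable.of_nonneg_of_le (hnn n) (hbd n hn) hsum, ?_⟩
  refine (tendsto_tsum_of_dominated_convergence (g := fun _ => (0 : ℝ)) hsum
    (fun k => ?_) ?_).trans (by simp)
  · have h1 : Tendsto (fun n => β k * (lam n / |lam k - lam n|)) atTop (nhds 0) := by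
      have h2 : Tendsto (fun n => |lam k - lam n|) atTop (nhds |lam k - 0|) :=
        (hlim.const_sub _).abs
      have h3 := (hlim.div h2 (by simpa using (hlpos k).ne')).const_mul (β k)
      simpa using h3
    refine squeeze_zero (fun n => hnn n k) (fun n => ?_) h1
    split_ifs
    · rw [div_div_eq_mul_div, mul_div_assoc]
    · have := hlpos n
      have := hβ k
      positivity
  · filter_upwards [eventually_ge_atTop N] with n hn k
    rw [Real.norm_of_nonneg (hnn n k)]
    exact hbd n hn k

/-- The weighted sum entering the Schur test is eventually small when the weights are the
relative spectral gaps shifted by a large multiple of `n ^ (-(1 + δ))`. -/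
theorem eventually_sum_div_gap_le {lam : ℕ → ℝ} {κ δ c : ℝ} (hκ : 0 < κ) (hδ : 0 < δ)
    (hc : 0 < c) (N : ℕ)
    (hlpos : ∀ n, 0 < lam n) (hlim : Tendsto lam atTop (nhds 0))
    (hgap : ∀ n k : ℕ, N ≤ n →
      κ * (|(k : ℝ) - n| / (max (k : ℝ) n + 1)) ≤ |lam k - lam n| / lam n) :
    ∀ᶠ n : ℕ in atTop, ∀ s : Finset ℕ,
      ∑ k ∈ s, c * ((k : ℝ) + 1) ^ (-(1 + δ)) /
        (|lam k - lam n| / lam n + 4 * c * ((n : ℝ) + 1) ^ (-(1 + δ))) ≤ 1 / 2 := by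
  obtain ⟨hsum1, hlim1⟩ := tendsto_tsum_low_indices (β := fun k => c * ((k : ℝ) + 1) ^ (-(1 + δ)))
    hκ N hlpos hlim (fun k => by positivity)
    ((summable_natCast_add_one_rpow_neg hδ).mul_left c) hgap
  have hZ : Summable fun m : ℤ => |(m : ℝ)| ^ (-(1 + δ / 2)) :=
    Real.summable_abs_int_rpow (by linarith)
  set Z := ∑' m : ℤ, |(m : ℝ)| ^ (-(1 + δ / 2)) with hZdef
  set D := 2 * c / κ * 2 ^ (δ / 2) with hDdef
  have hD : 0 < D := by positivity
  have hlim2 : Tendsto (fun n : ℕ => D * Z * ((n : ℝ) + 1) ^ (-(δ / 2))) atTop (nhds 0) := by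
    simpa using (tendsto_natCast_add_one_rpow_neg (half_pos hδ)).const_mul (D * Z)
  filter_upwards [eventually_ge_atTop N,
    hlim1.eventually_le_const (by norm_num : (0 : ℝ) < 1 / 8),
    hlim2.eventually_le_const (by norm_num : (0 : ℝ) < 1 / 8)] with n hn h1 h2 s
  have hln := hlpos n
  have hterm : ∀ k : ℕ, c * ((k : ℝ) + 1) ^ (-(1 + δ)) /
        (|lam k - lam n| / lam n + 4 * c * ((n : ℝ) + 1) ^ (-(1 + δ)))
      ≤ (if k = n then 1 / 4 else 0)
        + (if 2 * k < n then c * ((k : ℝ) + 1) ^ (-(1 + δ)) / (|lam k - lam n| / lam n) else 0)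
        + D * ((n : ℝ) + 1) ^ (-(δ / 2)) * |(((k : ℤ) - n : ℤ) : ℝ)| ^ (-(1 + δ / 2)) := by
    intro k
    have hlast : 0 ≤ D * ((n : ℝ) + 1) ^ (-(δ / 2)) *
        |(((k : ℤ) - n : ℤ) : ℝ)| ^ (-(1 + δ / 2)) := by positivity
    have hmid : 0 ≤ if 2 * k < n then
        c * ((k : ℝ) + 1) ^ (-(1 + δ)) / (|lam k - lam n| / lam n) else 0 := by
      split_ifs <;> positivity
    rcases eq_or_ne k n with rfl | hkn
    · rw [if_pos rfl]
      have : c * ((k : ℝ) + 1) ^ (-(1 + δ)) /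
        (|lam k - lam k| / lam k + 4 * c * ((k : ℝ) + 1) ^ (-(1 + δ))) = 1 / 4 := by
        have : 0 < ((k : ℝ) + 1) ^ (-(1 + δ)) := by positivity
        rw [sub_self, abs_zero, zero_div, zero_add]
        field_simp
      linarith
    have hkn' : (0 : ℝ) < |(k : ℝ) - n| :=
      abs_pos.2 (sub_ne_zero.2 (by exact_mod_cast hkn))
    have hW : 0 < |lam k - lam n| / lam n := lt_of_lt_of_le (by positivity) (hgap n k hn)
    have hdrop : c * ((k : ℝ) + 1) ^ (-(1 + δ)) /
        (|lam k - lam n| / lam n + 4 * c * ((n : ℝ) + 1) ^ (-(1 + δ)))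
        ≤ c * ((k : ℝ) + 1) ^ (-(1 + δ)) / (|lam k - lam n| / lam n) := by
      refine div_le_div_of_nonneg_left (by positivity) hW ?_
      have : 0 < 4 * c * ((n : ℝ) + 1) ^ (-(1 + δ)) := by positivity
      linarith
    rw [if_neg hkn, zero_add]
    by_cases hlow : 2 * k < n
    · rw [if_pos hlow]
      linarith
    rw [if_neg hlow, zero_add]
    refine hdrop.trans ?_
    have hlow' : (n : ℝ) ≤ 2 * k := by exact_mod_cast not_lt.1 hlow
    have hk0 : (0 : ℝ) ≤ k := k.cast_nonneg
    have hn0 : (0 : ℝ) ≤ n := n.cast_nonneg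
    push_cast
    set d := |(k : ℝ) - n| with hd
    have hdk : d ≤ k + 1 := abs_le.2 ⟨by linarith, by linarith⟩
    have hk1 : (0 : ℝ) < (k : ℝ) + 1 := by positivity
    have hWlow : κ * (d / (2 * ((k : ℝ) + 1))) ≤ |lam k - lam n| / lam n := by
      refine le_trans ?_ (hgap n k hn)
      have : max (k : ℝ) n + 1 ≤ 2 * ((k : ℝ) + 1) := by
        have : max (k : ℝ) n ≤ 2 * k + 1 := max_le (by linarith) (by linarith)
        linarith
      have hmax : 0 < max (k : ℝ) n + 1 := by positivity
      gcongr
    have hp1 : ((k : ℝ) + 1) ^ (-(δ / 2)) ≤ d ^ (-(δ / 2)) :=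
      Real.rpow_le_rpow_of_nonpos hkn' hdk (by linarith)
    have hp2 : ((k : ℝ) + 1) ^ (-(δ / 2)) ≤ 2 ^ (δ / 2) * ((n : ℝ) + 1) ^ (-(δ / 2)) := by
      have h3 : ((k : ℝ) + 1) ^ (-(δ / 2)) ≤ (((n : ℝ) + 1) / 2) ^ (-(δ / 2)) :=
        Real.rpow_le_rpow_of_nonpos (by positivity) (by linarith) (by linarith)
      refine h3.trans_eq ?_
      rw [Real.div_rpow (by positivity) two_pos.le, Real.rpow_neg two_pos.le, div_inv_eq_mul,
        mul_comm]
    have he1 : ((k : ℝ) + 1) ^ (-(1 + δ))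
        = ((k : ℝ) + 1)⁻¹ * (((k : ℝ) + 1) ^ (-(δ / 2)) * ((k : ℝ) + 1) ^ (-(δ / 2))) := by
      rw [← Real.rpow_neg_one, ← Real.rpow_add hk1, ← Real.rpow_add hk1]
      congr 1
      ring
    have he2 : d ^ (-(1 + δ / 2)) = d⁻¹ * d ^ (-(δ / 2)) := by
      rw [← Real.rpow_neg_one, ← Real.rpow_add hkn']
      congr 1
      ring
    calc c * ((k : ℝ) + 1) ^ (-(1 + δ)) / (|lam k - lam n| / lam n)
        ≤ c * ((k : ℝ) + 1) ^ (-(1 + δ)) / (κ * (d / (2 * ((k : ℝ) + 1)))) :=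
          div_le_div_of_nonneg_left (by positivity) (by positivity) hWlow
      _ = 2 * c / κ * d⁻¹ * (((k : ℝ) + 1) ^ (-(δ / 2)) * ((k : ℝ) + 1) ^ (-(δ / 2))) := by
          rw [he1]
          field_simp
      _ ≤ 2 * c / κ * d⁻¹ * ((2 ^ (δ / 2) * ((n : ℝ) + 1) ^ (-(δ / 2))) * d ^ (-(δ / 2))) := by
          gcongr
      _ = _ := by
          rw [he2, hDdef]
          ring
  refine (Finset.sum_le_sum fun k _ => hterm k).trans ?_
  rw [Finset.sum_add_distrib, Finset.sum_add_distrib, ← Finset.mul_sum]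
  have hs1 : ∑ k ∈ s, (if k = n then (1 / 4 : ℝ) else 0) ≤ 1 / 4 := by
    rw [Finset.sum_ite_eq']
    split_ifs <;> norm_num
  have hs2 := (hsum1 n hn).sum_le_tsum s fun k _ => by split_ifs <;> positivity
  have hs3 : ∑ k ∈ s, |(((k : ℤ) - n : ℤ) : ℝ)| ^ (-(1 + δ / 2)) ≤ Z := by
    have hinj : Function.Injective fun k : ℕ => (k : ℤ) - n := fun i j hij => by
      simpa using hij
    rw [← Finset.sum_image (f := fun m : ℤ => |(m : ℝ)| ^ (-(1 + δ / 2)))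
      (g := fun k : ℕ => (k : ℤ) - n) hinj.injOn]
    exact hZ.sum_le_tsum _ fun m _ => by positivity
  have hs4 : D * ((n : ℝ) + 1) ^ (-(δ / 2)) *
      ∑ k ∈ s, |(((k : ℤ) - n : ℤ) : ℝ)| ^ (-(1 + δ / 2)) ≤ 1 / 8 := by
    refine (mul_le_mul_of_nonneg_left hs3 (by positivity)).trans (le_trans (le_of_eq ?_) h2)
    ring
  linarith

/-- **Lemma 1.** Let `K`, `B` be self-adjoint compact operators on a Hilbert space `H`, with
`K` positive and `I + B` (strictly) positive. If the eigenvalues `lam n` of `K`, enumerated in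
decreasing order with multiplicity with normalized eigenvectors `h n`, satisfy
`lam n = (a n + b + O(n^(-δ)))^(-B')` and `‖B (h n)‖ ≤ c n^(-(1+δ))` as `n → ∞`, then the
eigenvalues `mu n` of the generalized eigenproblem `K 𝐡 = 𝛌 (𝐡 + B 𝐡)`, enumerated in
decreasing order with multiplicity, satisfy the same two-term asymptotics. -/
theorem lemma_two_term_asymp_preserved
    {H : Type*} [NormedAddCommGroup H] [InnerProductSpace ℝ H] [CompleteSpace H]
    (K B : H →L[ℝ] H)
    (hKsa : IsSelfAdjoint K) (hBsa : IsSelfAdjoint B)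
    (hKcomp : IsCompactOperator (⇑K)) (hBcomp : IsCompactOperator (⇑B))
    (hKpos : ∀ x : H, 0 ≤ ⟪K x, x⟫)
    (hIBpos : ∃ c₀ > (0 : ℝ), ∀ x : H, c₀ * ‖x‖ ^ 2 ≤ ⟪x + B x, x⟫)
    (a b B' δ c : ℝ) (ha : 0 < a) (hB' : 0 < B') (hδ : 0 < δ) (hc : 0 < c)
    -- `lam` enumerates the eigenvalues of `K` in decreasing order with multiplicity;
    -- `h` is a corresponding orthonormal basis of eigenvectors
    (lam : ℕ → ℝ) (h : ℕ → H)
    (hlpos : ∀ n, 0 < lam n) (hlanti : Antitone lam)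
    (heig : ∀ n, K (h n) = lam n • h n)
    (hon : Orthonormal ℝ h)
    (hcomplete : (Submodule.span ℝ (Set.range h)).topologicalClosure = ⊤)
    -- the asymptotic and perturbation hypotheses
    (hlasymp : HasTwoTermAsymp lam a b B' δ)
    (hBh : ∀ᶠ n in atTop, ‖B (h n)‖ ≤ c * ((n : ℝ) + 1) ^ (-(1 + δ)))
    -- `mu` enumerates the eigenvalues of the generalized eigenproblem `K 𝐡 = 𝛌 (𝐡 + B 𝐡)`
    -- in decreasing order with multiplicity: `g` is a complete system of generalized
    -- eigenvectors, orthonormal with respect to the inner product `⟪x + B x, y⟫`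
    (mu : ℕ → ℝ) (g : ℕ → H)
    (hmpos : ∀ n, 0 < mu n) (hmanti : Antitone mu)
    (hgeig : ∀ n, K (g n) = mu n • (g n + B (g n)))
    (hgon : ∀ n m, ⟪g n + B (g n), g m⟫ = if n = m then 1 else 0)
    (hgcomplete : (Submodule.span ℝ (Set.range g)).topologicalClosure = ⊤) :
    HasTwoTermAsymp mu a b B' δ := by
  obtain ⟨c', hc', hBh'⟩ : ∃ c' > (0 : ℝ), ∀ k, ‖B (h k)‖ ≤ c' * ((k : ℝ) + 1) ^ (-(1 + δ)) := by
    obtain ⟨N, hN⟩ := eventually_atTop.1 hBh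
    have hnn : ∀ k ∈ Finset.range N, 0 ≤ ‖B (h k)‖ * ((k : ℝ) + 1) ^ (1 + δ) :=
      fun k _ => by positivity
    have hS := Finset.sum_nonneg hnn
    refine ⟨c + ∑ k ∈ Finset.range N, ‖B (h k)‖ * ((k : ℝ) + 1) ^ (1 + δ), by linarith,
      fun k => ?_⟩
    rcases lt_or_ge k N with hk | hk
    · have h1 := Finset.single_le_sum hnn (Finset.mem_range.2 hk)
      rw [Real.rpow_neg (by positivity), ← div_eq_mul_inv, le_div_iff₀ (by positivity)]
      linarith
    · refine (hN k hk).trans (mul_le_mul_of_nonneg_right ?_ (by positivity))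
      linarith
  obtain ⟨κ, hκ, N, hgap⟩ := hlasymp.exists_abs_gap ha hB' hδ hlpos hlanti
  have hsum := eventually_sum_div_gap_le hκ hδ hc' N hlpos (hlasymp.tendsto_zero ha hB' hδ) hgap
  have hε1 : ∀ᶠ n : ℕ in atTop, 4 * c' * ((n : ℝ) + 1) ^ (-(1 + δ)) ≤ 1 := by
    have := (tendsto_natCast_add_one_rpow_neg (by linarith : 0 < 1 + δ)).const_mul (4 * c')
    rw [mul_zero] at this
    exact this.eventually_le_const one_pos
  have hBjk : ∀ j k, |⟪B (h j), h k⟫| ≤ √(c' * ((j : ℝ) + 1) ^ (-(1 + δ))) *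
      √(c' * ((k : ℝ) + 1) ^ (-(1 + δ))) := by
    have hle : ∀ j k, |⟪B (h j), h k⟫| ≤ c' * ((j : ℝ) + 1) ^ (-(1 + δ)) := fun j k => by
      have := abs_real_inner_le_norm (B (h j)) (h k)
      rw [hon.1 k, mul_one] at this
      exact this.trans (hBh' j)
    intro j k
    have hsymm : ⟪B (h j), h k⟫ = ⟪B (h k), h j⟫ := by
      rw [real_inner_comm]
      exact (hBsa.isSymmetric (h k) (h j)).symm
    have h2 : |⟪B (h j), h k⟫| ≤ c' * ((k : ℝ) + 1) ^ (-(1 + δ)) := hsymm ▸ hle k j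
    rw [← Real.sqrt_mul (by positivity)]
    refine Real.le_sqrt_of_sq_le ?_
    rw [sq]
    exact mul_le_mul (hle j k) h2 (abs_nonneg _) (by positivity)
  refine hlasymp.of_abs_sub_le ha hB' hδ hlpos hmpos (D := 4 * c') ?_
  filter_upwards [hsum, hε1] with n hn hn1
  exact abs_eigenvalue_sub_le K B hIBpos lam h hlpos hlanti heig hon hcomplete mu g hmanti hgeig
    hgon hgcomplete (fun k => c' * ((k : ℝ) + 1) ^ (-(1 + δ))) (fun k => by positivity) hBjk
    n _ (by positivity) hn1 hn
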